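/- Assume additionally γ_n ≤ 1 − ρ_n and n·ρ_n ≥ 1. Fix any realization x of the sampling matrix (a symmetric {0,1}-valued n×n matrix) and set S_x = {Θ ∈ T_k : ‖Θ − Θ̃‖²_{2,x} ≥ ε⁰, ‖Θ‖_∞ ≤ ρ_n, Θ_{ij} ≥ γ_n for all i < j} with ε⁰ = c₀·ρ_n·(ρ_n²/γ_n²)·(n·log k + k²). Then there exist absolute constants c₀, C, C' > 0 such that, with probability at least 1 − 5·exp(−C'·ρ_n·n·log k) over the randomness of A alone, simultaneously for every Θ ∈ S_x: | ΔK^{Θ*}_x(Θ, Θ̃) − ΔK^{A}_x(Θ, Θ̃) | ≤ (1/(128·ρ_n))·‖Θ − Θ̃‖²_{2,x} + C·(ρ_n²/γ_n²)·(n·log k + k²). -/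

import Mathlib

open MeasureTheory ProbabilityTheory

noncomputable section

/-- Kullback–Leibler divergence between Bernoulli(q) and Bernoulli(q'). -/
def klBer (q q' : ℝ) : ℝ :=
  q * Real.log (q / q') + (1 - q) * Real.log ((1 - q) / (1 - q'))

/-- Sum of `f i j` over pairs `i < j`. -/
def pairSum {n : ℕ} (f : Fin n → Fin n → ℝ) : ℝ :=
  ∑ i : Fin n, ∑ j : Fin n, if i < j then f i j else 0

/-- Weighted squared norm `‖M‖_{2,B}² = Σ_{i<j} B_{ij} M_{ij}²`. -/
def wNormSq {n : ℕ} (B M : Fin n → Fin n → ℝ) : ℝ :=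
  pairSum fun i j => B i j * M i j ^ 2

/-- Weighted Kullback–Leibler divergence `K_B(M, M') = Σ_{i<j} B_{ij} K(M_{ij}, M'_{ij})`. -/
def wKL {n : ℕ} (B M M' : Fin n → Fin n → ℝ) : ℝ :=
  pairSum fun i j => B i j * klBer (M i j) (M' i j)

/-- Entrywise supremum norm `‖M‖_∞`. -/
def supNorm {n : ℕ} (M : Fin n → Fin n → ℝ) : ℝ :=
  ⨆ i, ⨆ j, |M i j|

/-- `M ∈ T_k`: symmetric block-constant matrix with zero diagonal, built from a symmetric
`k × k` matrix `Q` and a label function `z : [n] → [k]`. -/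
def IsBlockConst (n k : ℕ) (M : Fin n → Fin n → ℝ) : Prop :=
  (∀ i, M i i = 0) ∧
  ∃ (z : Fin n → Fin k) (Q : Fin k → Fin k → ℝ),
    (∀ a b, Q a b = Q b a) ∧ ∀ i j, i ≠ j → M i j = Q (z i) (z j)

/-- A symmetric zero-diagonal random matrix whose above-diagonal entries are independent
Bernoulli random variables, `A_{ij} ~ Bernoulli(P_{ij})` for `i < j`. -/
def IsBernoulliMatrix {Ω : Type} [MeasurableSpace Ω] (μ : Measure Ω) {n : ℕ}
    (A : Ω → Fin n → Fin n → ℝ) (P : Fin n → Fin n → ℝ) : Prop :=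
  (∀ i j, Measurable fun ω => A ω i j) ∧
  (∀ ω i j, A ω i j = A ω j i) ∧
  (∀ ω i, A ω i i = 0) ∧
  (∀ ω i j, A ω i j = 0 ∨ A ω i j = 1) ∧
  (∀ i j, i < j → μ {ω | A ω i j = 1} = ENNReal.ofReal (P i j)) ∧
  iIndepFun
    (fun (p : {p : Fin n × Fin n // p.1 < p.2}) ω => A ω p.1.1 p.1.2) μ

/-- `ΔK^C_B(Θ, Θ') = K_B(C, Θ) - K_B(C, Θ')`. -/
def deltaKL {n : ℕ} (Cm B Θ Θ' : Fin n → Fin n → ℝ) : ℝ :=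
  wKL B Cm Θ - wKL B Cm Θ'

lemma summable_expabs : Summable fun j : ℤ => Real.exp (-|(j:ℝ)|) := by
  have h : Summable fun j : ℕ => Real.exp (-(j:ℝ)) := Real.summable_exp_neg_nat
  apply Summable.of_nat_of_neg
  · simpa using h
  · simpa using h

def gridK : ℝ := Real.exp (3/2) * ∑' j : ℤ, Real.exp (-|(j:ℝ)|)

lemma one_le_gridK : 1 ≤ gridK := by
  unfold gridK
  have h1 : (1:ℝ) ≤ Real.exp (3/2) := Real.one_le_exp (by norm_num)
  have h2 : (1:ℝ) ≤ ∑' j : ℤ, Real.exp (-|(j:ℝ)|) := by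
    have := summable_expabs.le_tsum (0:ℤ) (fun j _ => (Real.exp_pos _).le)
    simpa using this
  nlinarith

lemma grid1 (α β c κ : ℝ) (hc : c ∈ Set.Icc α β) (hκ : 0 < κ) :
    ∃ G : Finset ℝ, (∀ g ∈ G, g ∈ Set.Icc α β) ∧
      ∑ g ∈ G, Real.exp (-(κ/2) * (g - c)^2) ≤ gridK ∧
      ∀ s u, u ∈ Set.Icc α β → ∃ g ∈ G, -κ * (u - s)^2 ≤ -κ * (g - s)^2 + 1 := by
  classical
  obtain ⟨hc1, hc2⟩ := hc
  set δ : ℝ := 1 / Real.sqrt κ with hδ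
  have hs : 0 < Real.sqrt κ := Real.sqrt_pos.2 hκ
  have hδ0 : 0 < δ := by positivity
  have hκδ : κ * δ^2 = 1 := by
    rw [hδ, div_pow, Real.sq_sqrt hκ.le]; field_simp
  set gf : ℤ → ℝ := fun j => max α (min β (c + j * δ)) with hgf
  set J : Finset ℤ := Finset.Icc (-⌈(c-α)/δ⌉) ⌈(β-c)/δ⌉ with hJ
  have hJ1 : (0:ℤ) ≤ ⌈(c-α)/δ⌉ := Int.ceil_nonneg (by apply div_nonneg <;> linarith)
  have hJ2 : (0:ℤ) ≤ ⌈(β-c)/δ⌉ := Int.ceil_nonneg (by apply div_nonneg <;> linarith)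
  refine ⟨J.image gf, ?_, ?_, ?_⟩
  · intro g hg
    obtain ⟨j, _, rfl⟩ := Finset.mem_image.1 hg
    exact ⟨le_max_left _ _, max_le (by linarith) (min_le_left _ _)⟩
  · have h1 : ∑ g ∈ J.image gf, Real.exp (-(κ/2) * (g - c)^2)
        ≤ ∑ j ∈ J, Real.exp (-(κ/2) * (gf j - c)^2) := by
      rw [← Finset.sum_fiberwise_of_maps_to (s := J) (t := J.image gf) (g := gf)
        (fun j hj => Finset.mem_image_of_mem _ hj)]
      apply Finset.sum_le_sum
      intro g hg
      obtain ⟨j, hj, rfl⟩ := Finset.mem_image.1 hg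
      exact Finset.single_le_sum (f := fun j => Real.exp (-(κ/2) * (gf j - c)^2))
        (fun _ _ => (Real.exp_pos _).le) (Finset.mem_filter.2 ⟨hj, rfl⟩)
    refine h1.trans ?_
    have h2 : ∀ j ∈ J, Real.exp (-(κ/2) * (gf j - c)^2) ≤ Real.exp (3/2) * Real.exp (-|(j:ℝ)|) := by
      intro j hj
      rw [← Real.exp_add]
      apply Real.exp_le_exp.2
      rw [hJ, Finset.mem_Icc] at hj
      obtain ⟨hj1, hj2⟩ := hj
      have hA : (⌈(c-α)/δ⌉ : ℝ) < (c-α)/δ + 1 := Int.ceil_lt_add_one _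
      have hB : (⌈(β-c)/δ⌉ : ℝ) < (β-c)/δ + 1 := Int.ceil_lt_add_one _
      have hj1' : -(⌈(c-α)/δ⌉ : ℝ) ≤ j := by exact_mod_cast hj1
      have hj2' : (j:ℝ) ≤ (⌈(β-c)/δ⌉ : ℝ) := by exact_mod_cast hj2
      have hA' : (-(j:ℝ) - 1) * δ ≤ c - α := by
        have : -(j:ℝ) - 1 ≤ (c-α)/δ := by linarith
        rwa [le_div_iff₀ hδ0] at this
      have hB' : ((j:ℝ) - 1) * δ ≤ β - c := by
        have : (j:ℝ) - 1 ≤ (β-c)/δ := by linarith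
        rwa [le_div_iff₀ hδ0] at this
      by_cases hj0 : |(j:ℝ)| ≤ 1
      · nlinarith [sq_nonneg (gf j - c)]
      push Not at hj0
      have key : (|(j:ℝ)| - 1) * δ ≤ |gf j - c| := by
        rcases le_total 0 (j:ℝ) with h | h
        · rw [abs_of_nonneg h]
          refine le_trans ?_ (le_abs_self _)
          have : c + ((j:ℝ) - 1) * δ ≤ gf j :=
            le_max_of_le_right (le_min (by linarith) (by nlinarith))
          linarith
        · rw [abs_of_nonpos h]
          refine le_trans ?_ (neg_le_abs _)
          have : gf j ≤ c - (-(j:ℝ) - 1) * δ :=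
            max_le (by linarith) ((min_le_right _ _).trans (by nlinarith))
          linarith
      have key2 : ((|(j:ℝ)| - 1) * δ)^2 ≤ (gf j - c)^2 := by
        rw [← sq_abs (gf j - c)]
        exact pow_le_pow_left₀ (mul_nonneg (by linarith) hδ0.le) key 2
      have : κ * ((|(j:ℝ)| - 1) * δ)^2 = (|(j:ℝ)| - 1)^2 := by
        rw [mul_pow]; linear_combination (|(j:ℝ)| - 1)^2 * hκδ
      nlinarith [mul_le_mul_of_nonneg_left key2 hκ.le, sq_nonneg (|(j:ℝ)| - 2)]
    refine (Finset.sum_le_sum h2).trans ?_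
    rw [← Finset.mul_sum, gridK]
    exact mul_le_mul_of_nonneg_left (summable_expabs.sum_le_tsum _ (fun _ _ => (Real.exp_pos _).le))
      (Real.exp_pos _).le
  · rintro s u ⟨hu1, hu2⟩
    have hA : (c-α)/δ ≤ (⌈(c-α)/δ⌉ : ℝ) := Int.le_ceil _
    have hB : (β-c)/δ ≤ (⌈(β-c)/δ⌉ : ℝ) := Int.le_ceil _
    rcases le_total β s with h | h
    · refine ⟨gf ⌈(β-c)/δ⌉, Finset.mem_image_of_mem _ (by rw [hJ, Finset.mem_Icc]; omega), ?_⟩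
      have : gf ⌈(β-c)/δ⌉ = β := by
        rw [div_le_iff₀ hδ0] at hB
        simp only [hgf]
        rw [min_eq_left (by linarith), max_eq_right (by linarith)]
      rw [this]
      nlinarith [mul_nonneg hκ.le (mul_nonneg (sub_nonneg.2 hu2) (by linarith : 0 ≤ 2*s - u - β))]
    rcases le_total s α with h' | h'
    · refine ⟨gf (-⌈(c-α)/δ⌉), Finset.mem_image_of_mem _ (by rw [hJ, Finset.mem_Icc]; omega), ?_⟩
      have : gf (-⌈(c-α)/δ⌉) = α := by
        rw [div_le_iff₀ hδ0] at hA
        simp only [hgf]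
        push_cast
        rw [max_eq_left ((min_le_right _ _).trans (by linarith))]
      rw [this]
      nlinarith [mul_nonneg hκ.le (mul_nonneg (sub_nonneg.2 hu1) (by linarith : 0 ≤ u + α - 2*s))]
    · have hf1 : (⌊(s-c)/δ⌋ : ℝ) ≤ (s-c)/δ := Int.floor_le _
      have hf2 : (s-c)/δ < (⌊(s-c)/δ⌋ : ℝ) + 1 := Int.lt_floor_add_one _
      refine ⟨gf ⌊(s-c)/δ⌋, Finset.mem_image_of_mem _ ?_, ?_⟩
      · rw [hJ, Finset.mem_Icc]
        constructor
        · rw [Int.le_floor]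
          push_cast
          have : -((c-α)/δ) ≤ (s-c)/δ := by
            rw [← neg_div]; gcongr; linarith
          linarith
        · have : (s-c)/δ ≤ (β-c)/δ := by gcongr
          have h3 : (⌊(s-c)/δ⌋ : ℝ) ≤ (⌈(β-c)/δ⌉ : ℝ) := by linarith
          exact_mod_cast h3
      · rw [le_div_iff₀ hδ0] at hf1
        rw [div_lt_iff₀ hδ0] at hf2
        set j := ⌊(s-c)/δ⌋
        have e1 : gf j ≤ s := max_le h' ((min_le_right _ _).trans (by linarith))
        have e2 : s - δ ≤ gf j := le_max_of_le_right (le_min (by linarith) (by linarith))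
        have e3 : (gf j - s)^2 ≤ δ^2 := by nlinarith
        nlinarith [mul_le_mul_of_nonneg_left e3 hκ.le, mul_nonneg hκ.le (sq_nonneg (u - s))]

lemma grid2 {ι : Type*} (S : Finset ι) (y : ι → ℝ) (α β θ : ℝ) (hαβ : α ≤ β)
    (hy : ∀ p ∈ S, y p ∈ Set.Icc α β) (hθ : 0 < θ) :
    ∃ G : Finset ℝ, (∀ g ∈ G, g ∈ Set.Icc α β) ∧
      ∑ g ∈ G, Real.exp (-(θ/2) * ∑ p ∈ S, (g - y p)^2) ≤ gridK ∧
      ∀ (e : ι → ℝ) (u : ℝ), (S.Nonempty → u ∈ Set.Icc α β) → ∃ g ∈ G,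
        ∑ p ∈ S, (e p * (u - y p) - θ * (u - y p)^2) ≤
          ∑ p ∈ S, (e p * (g - y p) - θ * (g - y p)^2) + 1 := by
  rcases S.eq_empty_or_nonempty with rfl | hS
  · refine ⟨{α}, by simpa using hαβ, by simpa using one_le_gridK, fun e u _ => ⟨α, by simp⟩⟩
  have hm : (0:ℝ) < S.card := by exact_mod_cast hS.card_pos
  set m : ℝ := (S.card : ℝ) with hmdef
  set c : ℝ := (∑ p ∈ S, y p) / m with hcdef
  have hmc : m * c = ∑ p ∈ S, y p := by rw [hcdef]; field_simp
  have hc : c ∈ Set.Icc α β := by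
    constructor
    · rw [hcdef, le_div_iff₀ hm, mul_comm, hmdef, ← nsmul_eq_mul]
      exact Finset.card_nsmul_le_sum _ _ _ (fun p hp => (hy p hp).1)
    · rw [hcdef, div_le_iff₀ hm, mul_comm, hmdef, ← nsmul_eq_mul]
      exact Finset.sum_le_card_nsmul _ _ _ (fun p hp => (hy p hp).2)
  obtain ⟨G, hG1, hG2, hG3⟩ := grid1 α β c (θ * m) hc (by positivity)
  have hsq : ∀ u, ∑ p ∈ S, (u - y p)^2 = m * (u - c)^2 + ∑ p ∈ S, (c - y p)^2 := by
    intro u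
    simp only [sub_sq, Finset.sum_add_distrib, Finset.sum_sub_distrib, Finset.sum_const,
      nsmul_eq_mul, ← Finset.mul_sum, ← hmc, ← hmdef]
    ring
  refine ⟨G, hG1, le_trans (Finset.sum_le_sum fun g _ => ?_) hG2, ?_⟩
  · apply Real.exp_le_exp.2
    have : 0 ≤ ∑ p ∈ S, (c - y p)^2 := Finset.sum_nonneg fun _ _ => sq_nonneg _
    rw [hsq]
    nlinarith
  · intro e u hu
    obtain ⟨g, hg, hgu⟩ := hG3 (c + (∑ p ∈ S, e p) / (2 * (θ * m))) u (hu hS)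
    refine ⟨g, hg, ?_⟩
    have hlin : ∀ u, ∑ p ∈ S, (e p * (u - y p) - θ * (u - y p)^2) =
        (∑ p ∈ S, e p) * u - ∑ p ∈ S, e p * y p
          - θ * (m * (u - c)^2 + ∑ p ∈ S, (c - y p)^2) := by
      intro u
      rw [← hsq, Finset.sum_sub_distrib, ← Finset.mul_sum, Finset.sum_mul, ← Finset.sum_sub_distrib]
      simp only [mul_sub]
    rw [hlin, hlin]
    set E := ∑ p ∈ S, e p
    have hq : 2 * (θ * m) * (E / (2 * (θ * m))) = E := by field_simp
    set q := E / (2 * (θ * m))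
    rw [← hq]
    nlinarith
lemma sup_bound {Ω ι B : Type*} [Fintype B] [DecidableEq B] [MeasurableSpace Ω]
    (μ : Measure Ω) [IsProbabilityMeasure μ] (E : Finset ι) (b : ι → B) (X : ι → Ω → ℝ)
    (y : ι → ℝ) (α β ρ lam η t : ℝ) (hαβ : α ≤ β) (hy : ∀ p ∈ E, y p ∈ Set.Icc α β)
    (hlam : 0 < lam) (hη : 0 < η) (hl1 : lam * (β - α) ≤ 1)
    (hl2 : lam * ρ ≤ η / 2)
    (hch : ∀ c : ι → ℝ, (∀ p ∈ E, |c p| ≤ 1) → ∀ r,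
      μ.real {ω | r ≤ ∑ p ∈ E, c p * X p ω} ≤ Real.exp (ρ * ∑ p ∈ E, c p ^ 2 - r)) :
    μ.real {ω | ∃ u : B → ℝ, (∀ p ∈ E, u (b p) ∈ Set.Icc α β) ∧
      t ≤ ∑ p ∈ E, (X p ω * (u (b p) - y p) - η * (u (b p) - y p)^2)} ≤
      gridK ^ (Fintype.card B) * Real.exp (Fintype.card B - lam * t) := by
  classical
  have hθ : 0 < lam * η := mul_pos hlam hη
  have hgrid := fun a : B => grid2 (E.filter fun p => b p = a) y α β (lam * η) hαβ
    (fun p hp => hy p (Finset.mem_filter.1 hp).1) hθ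
  choose G hG1 hG2 hG3 using hgrid
  set N : ℝ := (Fintype.card B : ℝ) with hN
  -- decomposition of sums along blocks
  have hdec : ∀ f : ι → ℝ, ∑ p ∈ E, f p = ∑ a, ∑ p ∈ E.filter (fun p => b p = a), f p :=
    fun f => (Finset.sum_fiberwise E b f).symm
  set Q : (B → ℝ) → ℝ := fun g => ∑ p ∈ E, (g (b p) - y p)^2 with hQ
  set V : (B → ℝ) → Set Ω := fun g => {ω | lam * t - N + lam * η * Q g ≤
      ∑ p ∈ E, (lam * (g (b p) - y p)) * X p ω} with hV
  have hsub : {ω | ∃ u : B → ℝ, (∀ p ∈ E, u (b p) ∈ Set.Icc α β) ∧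
      t ≤ ∑ p ∈ E, (X p ω * (u (b p) - y p) - η * (u (b p) - y p)^2)} ⊆
      ⋃ g ∈ Fintype.piFinset G, V g := by
    rintro ω ⟨u, hu, ht⟩
    have hex := fun a : B => hG3 a (fun p => lam * X p ω) (u a) (by
      rintro ⟨p, hp⟩
      obtain ⟨hp1, rfl⟩ := Finset.mem_filter.1 hp
      exact hu p hp1)
    choose g hg hgu using hex
    simp only [Set.mem_iUnion]
    refine ⟨g, Fintype.mem_piFinset.2 hg, ?_⟩
    have h1 : lam * t ≤ ∑ p ∈ E, (lam * X p ω * (u (b p) - y p) - lam * η * (u (b p) - y p)^2) := by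
      refine (mul_le_mul_of_nonneg_left ht hlam.le).trans (le_of_eq ?_)
      rw [Finset.mul_sum]
      exact Finset.sum_congr rfl fun p _ => by ring
    have h2 : ∑ p ∈ E, (lam * X p ω * (u (b p) - y p) - lam * η * (u (b p) - y p)^2) ≤
        ∑ p ∈ E, (lam * X p ω * (g (b p) - y p) - lam * η * (g (b p) - y p)^2) + N := by
      rw [hdec, hdec]
      have : ∀ v : B → ℝ, ∑ a, ∑ p ∈ E.filter (fun p => b p = a),
          (lam * X p ω * (v (b p) - y p) - lam * η * (v (b p) - y p)^2) =
          ∑ a, ∑ p ∈ E.filter (fun p => b p = a),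
          (lam * X p ω * (v a - y p) - lam * η * (v a - y p)^2) := by
        intro v
        refine Finset.sum_congr rfl fun a _ => Finset.sum_congr rfl fun p hp => ?_
        rw [(Finset.mem_filter.1 hp).2]
      rw [this, this]
      have h3 := Finset.sum_le_sum (s := Finset.univ) fun a _ => hgu a
      refine h3.trans (le_of_eq ?_)
      rw [Finset.sum_add_distrib]
      simp [hN]
    have h4 : ∑ p ∈ E, (lam * X p ω * (g (b p) - y p) - lam * η * (g (b p) - y p)^2) =
        ∑ p ∈ E, (lam * (g (b p) - y p)) * X p ω - lam * η * Q g := by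
      rw [Finset.sum_sub_distrib, hQ, Finset.mul_sum]
      congr 1
      exact Finset.sum_congr rfl fun p _ => by ring
    show lam * t - N + lam * η * Q g ≤ _
    linarith
  have hVg : ∀ g ∈ Fintype.piFinset G, μ.real (V g) ≤
      Real.exp (N - lam * t) * ∏ a, Real.exp (-(lam * η / 2) *
        ∑ p ∈ E.filter (fun p => b p = a), (g a - y p)^2) := by
    intro g hg
    refine (hch (fun p => lam * (g (b p) - y p)) ?_ _).trans ?_
    · intro p hp
      have h1 := hG1 _ _ (Fintype.mem_piFinset.1 hg (b p))
      have h2 := hy p hp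
      rw [abs_mul, abs_of_pos hlam]
      refine le_trans (mul_le_mul_of_nonneg_left ?_ hlam.le) hl1
      rw [abs_le]
      constructor <;> linarith [h1.1, h1.2, h2.1, h2.2]
    · rw [← Real.exp_sum, ← Real.exp_add]
      apply Real.exp_le_exp.2
      have hQ' : Q g = ∑ a, ∑ p ∈ E.filter (fun p => b p = a), (g a - y p)^2 := by
        rw [hQ]
        simp only
        rw [hdec]
        refine Finset.sum_congr rfl fun a _ => Finset.sum_congr rfl fun p hp => ?_
        rw [(Finset.mem_filter.1 hp).2]
      rw [← Finset.mul_sum, ← hQ']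
      have hQ0 : 0 ≤ Q g := Finset.sum_nonneg fun _ _ => sq_nonneg _
      have : ∑ p ∈ E, (lam * (g (b p) - y p))^2 = lam^2 * Q g := by
        rw [hQ, Finset.mul_sum]
        exact Finset.sum_congr rfl fun p _ => by ring
      rw [this]
      nlinarith [mul_le_mul_of_nonneg_right hl2 (mul_nonneg hlam.le hQ0)]
  calc _ ≤ μ.real (⋃ g ∈ Fintype.piFinset G, V g) := measureReal_mono hsub (measure_ne_top _ _)
    _ ≤ ∑ g ∈ Fintype.piFinset G, μ.real (V g) := measureReal_biUnion_finset_le _ _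
    _ ≤ ∑ g ∈ Fintype.piFinset G, Real.exp (N - lam * t) * ∏ a, Real.exp (-(lam * η / 2) *
        ∑ p ∈ E.filter (fun p => b p = a), (g a - y p)^2) := Finset.sum_le_sum hVg
    _ = Real.exp (N - lam * t) * ∏ a, ∑ g ∈ G a, Real.exp (-(lam * η / 2) *
        ∑ p ∈ E.filter (fun p => b p = a), (g - y p)^2) := by
        rw [← Finset.mul_sum, Finset.prod_univ_sum]
    _ ≤ Real.exp (N - lam * t) * gridK ^ (Fintype.card B) := by
        refine mul_le_mul_of_nonneg_left ?_ (Real.exp_pos _).le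
        refine (Finset.prod_le_prod (fun a _ => Finset.sum_nonneg fun _ _ => (Real.exp_pos _).le)
          fun a _ => hG2 a).trans (le_of_eq ?_)
        simp
    _ = _ := mul_comm _ _

lemma chernoff {Ω : Type} [MeasurableSpace Ω] (μ : Measure Ω) [IsProbabilityMeasure μ] {n : ℕ}
    (A : Ω → Fin n → Fin n → ℝ) (P : Fin n → Fin n → ℝ) (hA : IsBernoulliMatrix μ A P)
    (γ ρ : ℝ) (hγ : 0 < γ) (hP : ∀ i j : Fin n, i < j → P i j ∈ Set.Icc γ ρ)
    (E : Finset {p : Fin n × Fin n // p.1 < p.2})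
    (c : {p : Fin n × Fin n // p.1 < p.2} → ℝ) (hc : ∀ p ∈ E, |c p| ≤ 1) (r : ℝ) :
    μ.real {ω | r ≤ ∑ p ∈ E, c p * (A ω p.1.1 p.1.2 - P p.1.1 p.1.2)} ≤
      Real.exp (ρ * ∑ p ∈ E, c p ^ 2 - r) := by
  obtain ⟨hm, -, -, h01, hprob, hind⟩ := hA
  set Y : {p : Fin n × Fin n // p.1 < p.2} → Ω → ℝ :=
    fun p ω => c p * (A ω p.1.1 p.1.2 - P p.1.1 p.1.2) with hY
  have hYm : ∀ p, Measurable (Y p) := fun p => ((hm _ _).sub_const _).const_mul _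
  have hYind : iIndepFun Y μ :=
    hind.comp (fun p a => c p * (a - P p.1.1 p.1.2)) (fun p => by fun_prop)
  have hmgf : ∀ p ∈ E, mgf (Y p) μ 1 ≤ Real.exp (ρ * c p ^ 2) := by
    intro p hp
    have hpp := hP _ _ p.2
    set q := P p.1.1 p.1.2
    have hAint : Integrable (fun ω => A ω p.1.1 p.1.2) μ := by
      refine Integrable.of_bound (hm _ _).aestronglyMeasurable 1 (ae_of_all _ fun ω => ?_)
      rcases h01 ω p.1.1 p.1.2 with h | h <;> simp [h]
    have hEA : ∫ ω, A ω p.1.1 p.1.2 ∂μ = q := by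
      have : (fun ω => A ω p.1.1 p.1.2) =
          Set.indicator {ω | A ω p.1.1 p.1.2 = 1} (fun _ => (1:ℝ)) := by
        funext ω
        rcases h01 ω p.1.1 p.1.2 with h | h <;> simp [Set.indicator, h]
      rw [this, integral_indicator_const (1:ℝ)
        (show MeasurableSet {ω | A ω p.1.1 p.1.2 = 1} from
          hm p.1.1 p.1.2 (measurableSet_singleton 1))]
      simp only [smul_eq_mul, mul_one, Measure.real]
      rw [hprob _ _ p.2, ENNReal.toReal_ofReal (by linarith [hpp.1])]
    have hpt : ∀ ω, Real.exp (1 * Y p ω) =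
        Real.exp (-(c p * q)) + (Real.exp (-(c p * q)) * (Real.exp (c p) - 1)) * A ω p.1.1 p.1.2 := by
      intro ω
      rcases h01 ω p.1.1 p.1.2 with h | h
      · simp [hY, h, q]
      · simp only [hY, h]
        rw [show 1 * (c p * (1 - q)) = -(c p * q) + c p by ring, Real.exp_add]; ring
    have hval : mgf (Y p) μ 1 = Real.exp (-(c p * q)) * (1 + q * (Real.exp (c p) - 1)) := by
      unfold mgf
      simp_rw [hpt]
      rw [integral_add (integrable_const _) (hAint.const_mul _), integral_const_mul, hEA]
      simp; ring
    rw [hval]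
    have h1 : 1 + q * (Real.exp (c p) - 1) ≤ Real.exp (q * (Real.exp (c p) - 1)) := by
      linarith [Real.add_one_le_exp (q * (Real.exp (c p) - 1))]
    refine (mul_le_mul_of_nonneg_left h1 (Real.exp_pos _).le).trans ?_
    rw [← Real.exp_add]
    apply Real.exp_le_exp.2
    have h2 := (abs_le.1 (Real.abs_exp_sub_one_sub_id_le (hc p hp))).2
    nlinarith [hpp.1, hpp.2, sq_nonneg (c p)]
  have hsum : mgf (∑ p ∈ E, Y p) μ 1 ≤ Real.exp (ρ * ∑ p ∈ E, c p ^ 2) := by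
    rw [hYind.mgf_sum hYm, Finset.mul_sum, Real.exp_sum]
    exact Finset.prod_le_prod (fun _ _ => mgf_nonneg) hmgf
  have hint : Integrable (fun ω => Real.exp (1 * (∑ p ∈ E, Y p) ω)) μ := by
    refine hYind.integrable_exp_mul_sum hYm fun p _ => ?_
    refine Integrable.of_bound (by have := hYm p; fun_prop) (Real.exp (|c p| * (1 + |P p.1.1 p.1.2|)))
      (ae_of_all _ fun ω => ?_)
    rw [Real.norm_eq_abs, Real.abs_exp]
    apply Real.exp_le_exp.2
    rw [one_mul]
    refine (le_abs_self _).trans ?_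
    simp only [hY]
    rw [abs_mul]
    refine mul_le_mul_of_nonneg_left ((abs_sub _ _).trans ?_) (abs_nonneg _)
    rcases h01 ω p.1.1 p.1.2 with h | h <;> simp [h]
  have := measure_ge_le_exp_mul_mgf (μ := μ) (X := ∑ p ∈ E, Y p) (t := 1) r zero_le_one hint
  have heq : {ω | r ≤ ∑ p ∈ E, c p * (A ω p.1.1 p.1.2 - P p.1.1 p.1.2)} =
      {ω | r ≤ (∑ p ∈ E, Y p) ω} := by
    ext ω; simp [hY, Finset.sum_apply]
  rw [heq]
  refine this.trans ((mul_le_mul_of_nonneg_left hsum (Real.exp_pos _).le).trans (le_of_eq ?_))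
  rw [← Real.exp_add]
  congr 1
  ring

def logit (t : ℝ) : ℝ := Real.log t - Real.log (1 - t)

lemma logit_mono {γ ρ s t : ℝ} (hγ : 0 < γ) (hρ : γ ≤ 1 - ρ) (ht : t ∈ Set.Icc γ ρ)
    (hs : s ∈ Set.Icc γ ρ) (hts : t ≤ s) :
    logit t ≤ logit s ∧ logit s - logit t ≤ 2 / γ * (s - t) := by
  obtain ⟨ht1, ht2⟩ := ht
  obtain ⟨hs1, hs2⟩ := hs
  have a1 : 0 < t := by linarith
  have a2 : 0 < s := by linarith
  have a3 : 0 < 1 - t := by linarith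
  have a4 : 0 < 1 - s := by linarith
  unfold logit
  constructor
  · have := Real.log_le_log a1 hts
    have := Real.log_le_log a4 (by linarith : 1 - s ≤ 1 - t)
    linarith
  · have h1 := Real.log_le_sub_one_of_pos (div_pos a2 a1)
    have h2 := Real.log_le_sub_one_of_pos (div_pos a3 a4)
    rw [Real.log_div a2.ne' a1.ne'] at h1
    rw [Real.log_div a3.ne' a4.ne'] at h2
    have h3 : s / t - 1 ≤ (s - t) / γ := by
      rw [show s / t - 1 = (s - t) / t by field_simp]
      exact div_le_div_of_nonneg_left (by linarith) hγ ht1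
    have h4 : (1 - t) / (1 - s) - 1 ≤ (s - t) / γ := by
      rw [show (1 - t) / (1 - s) - 1 = (s - t) / (1 - s) by field_simp; ring]
      exact div_le_div_of_nonneg_left (by linarith) hγ (by linarith)
    have : 2 / γ * (s - t) = (s - t) / γ + (s - t) / γ := by ring
    linarith

lemma logit_sq {γ ρ s t : ℝ} (hγ : 0 < γ) (hρ : γ ≤ 1 - ρ) (ht : t ∈ Set.Icc γ ρ)
    (hs : s ∈ Set.Icc γ ρ) : (logit s - logit t)^2 ≤ 4 / γ^2 * (s - t)^2 := by
  have : 4 / γ^2 * (s - t)^2 = (2 / γ * (s - t))^2 := by ring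
  rw [this]
  rcases le_total t s with h | h
  · obtain ⟨h1, h2⟩ := logit_mono hγ hρ ht hs h
    exact pow_le_pow_left₀ (by linarith) h2 2
  · obtain ⟨h1, h2⟩ := logit_mono hγ hρ hs ht h
    nlinarith [pow_le_pow_left₀ (by linarith) h2 2]

lemma kl_diff {q s t : ℝ} (hs : s ∈ Set.Ioo (0:ℝ) 1)
    (ht : t ∈ Set.Ioo (0:ℝ) 1) : klBer q s - klBer q t =
      -(q * (logit s - logit t)) - (Real.log (1 - s) - Real.log (1 - t)) := by
  have key : ∀ s : ℝ, s ∈ Set.Ioo (0:ℝ) 1 → klBer q s =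
      q * Real.log q - q * Real.log s + ((1 - q) * Real.log (1 - q) - (1 - q) * Real.log (1 - s)) := by
    intro s hs
    unfold klBer
    have e1 : q * Real.log (q / s) = q * Real.log q - q * Real.log s := by
      rcases eq_or_ne q 0 with h | h
      · simp [h]
      · rw [Real.log_div h hs.1.ne']; ring
    have e2 : (1 - q) * Real.log ((1 - q) / (1 - s)) =
        (1 - q) * Real.log (1 - q) - (1 - q) * Real.log (1 - s) := by
      rcases eq_or_ne (1 - q) 0 with h | h
      · simp [h]
      · rw [Real.log_div h (by linarith [hs.2])]; ring
    rw [e1, e2]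
  rw [key s hs, key t ht]
  unfold logit
  ring

lemma pairSum_eq {n : ℕ} (f : Fin n → Fin n → ℝ) :
    pairSum f = ∑ p : {p : Fin n × Fin n // p.1 < p.2}, f p.1.1 p.1.2 := by
  classical
  unfold pairSum
  rw [← Fintype.sum_prod_type' (fun i j : Fin n => if i < j then f i j else 0),
    ← Finset.sum_filter]
  exact (Finset.sum_subtype (Finset.univ.filter fun p : Fin n × Fin n => p.1 < p.2)
    (by simp) (fun p => f p.1 p.2))

lemma pairSum_x {n : ℕ} (x : Fin n → Fin n → ℝ) (hx : ∀ i j, x i j = 0 ∨ x i j = 1)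
    (f : Fin n → Fin n → ℝ) :
    pairSum (fun i j => x i j * f i j) =
      ∑ p ∈ Finset.univ.filter (fun p : {p : Fin n × Fin n // p.1 < p.2} => x p.1.1 p.1.2 = 1),
        f p.1.1 p.1.2 := by
  rw [pairSum_eq, Finset.sum_filter]
  refine Finset.sum_congr rfl fun p _ => ?_
  rcases hx p.1.1 p.1.2 with h | h <;> simp [h]
theorem stmt_19 :
    ∃ c₀ : ℝ, 0 < c₀ ∧ ∃ C : ℝ, 0 < C ∧ ∃ C' : ℝ, 0 < C' ∧
      ∀ (n : ℕ), 2 ≤ n → ∀ (k : ℕ), 1 ≤ k →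
      ∀ (γ ρ : ℝ), 0 < γ → γ ≤ ρ → ρ < 1 → γ ≤ 1 - ρ → 1 ≤ (n : ℝ) * ρ →
      ∀ (Ω : Type) [MeasurableSpace Ω] (μ : Measure Ω), IsProbabilityMeasure μ →
      ∀ (Θstar Θtil : Fin n → Fin n → ℝ) (A : Ω → Fin n → Fin n → ℝ)
        (x : Fin n → Fin n → ℝ),
        -- Θ* symmetric, zero diagonal, entries in [γ, ρ]
        (∀ i j, Θstar i j = Θstar j i) → (∀ i, Θstar i i = 0) →
        (∀ i j : Fin n, i < j → Θstar i j ∈ Set.Icc γ ρ) →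
        -- A : Bernoulli(Θ*) adjacency matrix
        IsBernoulliMatrix μ A Θstar →
        -- Θ̃ symmetric, zero diagonal, off-diagonal entries in [γ, ρ]
        (∀ i j, Θtil i j = Θtil j i) → (∀ i, Θtil i i = 0) →
        (∀ i j : Fin n, i < j → Θtil i j ∈ Set.Icc γ ρ) →
        -- a fixed realization x of the sampling matrix: symmetric with {0,1} entries
        (∀ i j, x i j = x j i) → (∀ i j, x i j = 0 ∨ x i j = 1) →
        ENNReal.ofReal (1 - 5 * Real.exp (-(C' * ρ * n * Real.log k))) ≤
          μ {ω | ∀ Θ : Fin n → Fin n → ℝ,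
              IsBlockConst n k Θ → supNorm Θ ≤ ρ →
              (∀ i j : Fin n, i < j → γ ≤ Θ i j) →
              c₀ * ρ * (ρ ^ 2 / γ ^ 2) * (n * Real.log k + (k : ℝ) ^ 2) ≤
                wNormSq x (fun i j => Θ i j - Θtil i j) →
              |deltaKL Θstar x Θ Θtil - deltaKL (A ω) x Θ Θtil| ≤
                1 / (128 * ρ) * wNormSq x (fun i j => Θ i j - Θtil i j) +
                  C * (ρ ^ 2 / γ ^ 2) * (n * Real.log k + (k : ℝ) ^ 2)} := by
  classical
  refine ⟨1, one_pos, 1024 * (2 + Real.log gridK), ?_, 1, one_pos, ?_⟩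
  · have := Real.log_nonneg one_le_gridK
    positivity
  intro n hn k hk γ ρ hγ hγρ hρ1 hγ1 hnρ Ω _ μ hμ Θstar Θtil A x hs1 hs2 hs3 hA ht1 ht2 ht3 hx1 hx2
  have hlK := Real.log_nonneg one_le_gridK
  have hρ : 0 < ρ := lt_of_lt_of_le hγ hγρ
  have hk1 : (1:ℝ) ≤ k := by exact_mod_cast hk
  have hlogk : 0 ≤ Real.log k := Real.log_nonneg hk1
  set L : ℝ := n * Real.log k + (k:ℝ)^2 with hL
  set C : ℝ := 1024 * (2 + Real.log gridK) with hC
  set t : ℝ := C * (ρ^2 / γ^2) * L with ht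
  set η : ℝ := γ^2 / (512 * ρ) with hη
  set lam : ℝ := γ^2 / (1024 * ρ^2) with hlam
  have hη0 : 0 < η := by positivity
  have hlam0 : 0 < lam := by positivity
  set E := Finset.univ.filter
    (fun p : {p : Fin n × Fin n // p.1 < p.2} => x p.1.1 p.1.2 = 1) with hE
  have hγm : γ ∈ Set.Icc γ ρ := ⟨le_rfl, hγρ⟩
  have hρm : ρ ∈ Set.Icc γ ρ := ⟨hγρ, le_rfl⟩
  have hαβ := logit_mono hγ hγ1 hγm hρm hγρ
  have hmem : ∀ s ∈ Set.Icc γ ρ, logit s ∈ Set.Icc (logit γ) (logit ρ) := fun s hs =>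
    ⟨(logit_mono hγ hγ1 hγm hs hs.1).1, (logit_mono hγ hγ1 hs hρm hs.2).1⟩
  set y : {p : Fin n × Fin n // p.1 < p.2} → ℝ := fun p => logit (Θtil p.1.1 p.1.2) with hy
  set Bad : (Fin n → Fin k) → ℝ → Set Ω := fun z σ =>
    {ω | ∃ u : Fin k × Fin k → ℝ, (∀ p ∈ E, u (z p.1.1, z p.1.2) ∈ Set.Icc (logit γ) (logit ρ)) ∧
      t ≤ ∑ p ∈ E, (σ * (A ω p.1.1 p.1.2 - Θstar p.1.1 p.1.2) * (u (z p.1.1, z p.1.2) - y p)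
        - η * (u (z p.1.1, z p.1.2) - y p)^2)} with hBad
  have hlt : lam * t = (2 + Real.log gridK) * L := by
    rw [hlam, ht, hC]; field_simp
  have hBadP : ∀ z σ, |σ| = 1 → μ.real (Bad z σ) ≤
      Real.exp ((1 + Real.log gridK) * (k:ℝ)^2 - (2 + Real.log gridK) * L) := by
    intro z σ hσ
    have hb := sup_bound μ E (fun p => (z p.1.1, z p.1.2))
      (fun p ω => σ * (A ω p.1.1 p.1.2 - Θstar p.1.1 p.1.2)) y (logit γ) (logit ρ) ρ lam η t
      hαβ.1 (fun p _ => hmem _ (ht3 _ _ p.2)) hlam0 hη0 ?_ ?_ ?_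
    · refine hb.trans (le_of_eq ?_)
      rw [hlt, ← Real.exp_log (pow_pos (lt_of_lt_of_le one_pos one_le_gridK) _), ← Real.exp_add,
        Real.log_pow]
      simp only [Fintype.card_prod, Fintype.card_fin]
      push_cast
      congr 1
      ring
    · refine (mul_le_mul_of_nonneg_left hαβ.2 hlam0.le).trans ?_
      rw [hlam]
      have : γ^2 / (1024 * ρ^2) * (2 / γ * (ρ - γ)) = (2 * γ * (ρ - γ)) / (1024 * ρ^2) := by
        field_simp
      rw [this, div_le_one (by positivity)]
      nlinarith
    · rw [hlam, hη]
      apply le_of_eq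
      field_simp
      norm_num
    · intro c hc r
      have := chernoff μ A Θstar hA γ ρ hγ hs3 E (fun p => c p * σ)
        (fun p hp => by rw [abs_mul, hσ, mul_one]; exact hc p hp) r
      have hσ2 : σ^2 = 1 := by rw [← sq_abs, hσ, one_pow]
      simp only [mul_pow, hσ2, mul_one, mul_assoc] at this
      exact this
  set S : Set Ω := {ω | ∀ Θ : Fin n → Fin n → ℝ,
              IsBlockConst n k Θ → supNorm Θ ≤ ρ →
              (∀ i j : Fin n, i < j → γ ≤ Θ i j) →
              1 * ρ * (ρ ^ 2 / γ ^ 2) * L ≤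
                wNormSq x (fun i j => Θ i j - Θtil i j) →
              |deltaKL Θstar x Θ Θtil - deltaKL (A ω) x Θ Θtil| ≤
                1 / (128 * ρ) * wNormSq x (fun i j => Θ i j - Θtil i j) + t} with hS
  have hsub : Sᶜ ⊆ (⋃ z, Bad z 1) ∪ (⋃ z, Bad z (-1)) := by
    intro ω hω
    by_contra hbad
    apply hω
    simp only [Set.mem_union, Set.mem_iUnion, not_or, not_exists] at hbad
    obtain ⟨hb1, hb2⟩ := hbad
    intro Θ hΘ hsup hΘγ _
    have hΘm : ∀ i j : Fin n, i < j → Θ i j ∈ Set.Icc γ ρ := by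
      intro i j hij
      refine ⟨hΘγ i j hij, (le_abs_self _).trans (le_trans ?_ hsup)⟩
      unfold supNorm
      exact (le_ciSup (f := fun j => |Θ i j|) (Set.finite_range _).bddAbove j).trans
        (le_ciSup (f := fun i => ⨆ j, |Θ i j|) (Set.finite_range _).bddAbove i)
    obtain ⟨-, z, Q, hQ, hzQ⟩ := hΘ
    set u : Fin k × Fin k → ℝ := fun a => logit (Q a.1 a.2) with hu
    have hup : ∀ p : {p : Fin n × Fin n // p.1 < p.2},
        u (z p.1.1, z p.1.2) = logit (Θ p.1.1 p.1.2) := by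
      intro p
      rw [hu, hzQ _ _ p.2.ne]
    have hum : ∀ p ∈ E, u (z p.1.1, z p.1.2) ∈ Set.Icc (logit γ) (logit ρ) := by
      intro p _
      rw [hup]
      exact hmem _ (hΘm _ _ p.2)
    set W := ∑ p ∈ E, (A ω p.1.1 p.1.2 - Θstar p.1.1 p.1.2) *
      (logit (Θ p.1.1 p.1.2) - y p) with hW
    set R := ∑ p ∈ E, (logit (Θ p.1.1 p.1.2) - y p)^2 with hR
    have hdec : ∀ σ : ℝ, ∑ p ∈ E, (σ * (A ω p.1.1 p.1.2 - Θstar p.1.1 p.1.2) *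
        (u (z p.1.1, z p.1.2) - y p) - η * (u (z p.1.1, z p.1.2) - y p)^2) = σ * W - η * R := by
      intro σ
      rw [Finset.sum_sub_distrib, hW, hR, Finset.mul_sum, Finset.mul_sum]
      congr 1 <;> refine Finset.sum_congr rfl fun p _ => ?_ <;> rw [hup]
      ring
    have hW1 : W - η * R < t := by
      by_contra hcon
      exact hb1 z ⟨u, hum, by rw [hdec]; linarith⟩
    have hW2 : -W - η * R < t := by
      by_contra hcon
      exact hb2 z ⟨u, hum, by rw [hdec]; linarith⟩
    have hRN : η * R ≤ 1 / (128 * ρ) * wNormSq x (fun i j => Θ i j - Θtil i j) := by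
      have h1 : wNormSq x (fun i j => Θ i j - Θtil i j) =
          ∑ p ∈ E, (Θ p.1.1 p.1.2 - Θtil p.1.1 p.1.2)^2 := by
        unfold wNormSq
        exact pairSum_x x hx2 (fun i j => (Θ i j - Θtil i j)^2)
      have h2 : R ≤ 4 / γ^2 * wNormSq x (fun i j => Θ i j - Θtil i j) := by
        rw [h1, hR, Finset.mul_sum]
        exact Finset.sum_le_sum fun p _ => logit_sq hγ hγ1 (ht3 _ _ p.2) (hΘm _ _ p.2)
      refine (mul_le_mul_of_nonneg_left h2 hη0.le).trans (le_of_eq ?_)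
      rw [hη]
      field_simp
      ring
    have hdk : ∀ Cm : Fin n → Fin n → ℝ, deltaKL Cm x Θ Θtil = ∑ p ∈ E,
        (-(Cm p.1.1 p.1.2 * (logit (Θ p.1.1 p.1.2) - y p)) -
          (Real.log (1 - Θ p.1.1 p.1.2) - Real.log (1 - Θtil p.1.1 p.1.2))) := by
      intro Cm
      unfold deltaKL wKL
      rw [pairSum_x x hx2 (fun i j => klBer (Cm i j) (Θ i j)),
        pairSum_x x hx2 (fun i j => klBer (Cm i j) (Θtil i j)), ← Finset.sum_sub_distrib]
      refine Finset.sum_congr rfl fun p _ => ?_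
      have h1 := hΘm _ _ p.2
      have h2 := ht3 _ _ p.2
      exact kl_diff ⟨by linarith [h1.1], by linarith [h1.2]⟩ ⟨by linarith [h2.1], by linarith [h2.2]⟩
    have hfin : deltaKL Θstar x Θ Θtil - deltaKL (A ω) x Θ Θtil = W := by
      rw [hdk, hdk, ← Finset.sum_sub_distrib, hW]
      exact Finset.sum_congr rfl fun p _ => by ring
    rw [hfin, abs_le]
    constructor <;> linarith
  have hun : ∀ σ : ℝ, |σ| = 1 → μ.real (⋃ z, Bad z σ) ≤ Real.exp (-(1 * ρ * n * Real.log k)) := by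
    intro σ hσ
    refine (measureReal_iUnion_fintype_le _).trans
      ((Finset.sum_le_sum fun z _ => hBadP z σ hσ).trans ?_)
    rw [Finset.sum_const, nsmul_eq_mul]
    have : ((Finset.univ : Finset (Fin n → Fin k)).card : ℝ) = Real.exp (n * Real.log k) := by
      rw [← Real.log_pow, Real.exp_log (by positivity)]
      simp
    rw [this, ← Real.exp_add]
    apply Real.exp_le_exp.2
    have h0 : 0 ≤ (n:ℝ) * Real.log k := by positivity
    have h1 : ρ * (n * Real.log k) ≤ 1 * (n * Real.log k) :=
      mul_le_mul_of_nonneg_right hρ1.le h0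
    rw [hL]
    nlinarith [mul_nonneg hlK h0, sq_nonneg (k:ℝ)]
  have hSc : μ.real Sᶜ ≤ 5 * Real.exp (-(1 * ρ * n * Real.log k)) := by
    have h1 := (measureReal_mono (μ := μ) hsub).trans (measureReal_union_le _ _)
    have h2 := hun 1 (by simp)
    have h3 := hun (-1) (by simp)
    have h4 := Real.exp_pos (-(1 * ρ * n * Real.log k))
    linarith
  have hSS : 1 ≤ μ.real S + μ.real Sᶜ := by
    have := measureReal_union_le (μ := μ) S Sᶜ
    rwa [Set.union_compl_self, probReal_univ] at this
  calc _ ≤ ENNReal.ofReal (μ.real S) := ENNReal.ofReal_le_ofReal (by linarith)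
    _ = μ S := by simp
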